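/- Let G = (V,E) be a finite simple graph, let H, U ⊆ E be disjoint edge sets, let t > 0 be a real number, and let W ⊆ V be a vertex set that contains every vertex v ∈ V with deg_U(v) ≤ t. Let F = {e ∈ H ∪ U : both endpoints of e lie in W}. Then μ(H ∪ U) ≤ μ(F) + 2·|U|/t. -/

import Mathlib

open Finset
open scoped Classical

/-- The degree of a vertex `v` in an edge set `H`: the number of edges of `H` incident to `v`. -/
noncomputable def degV {V : Type*} (H : Finset (Sym2 V)) (v : V) : ℕ :=
  (H.filter (fun e => v ∈ e)).card

/-- The edge degree of an unordered pair `e = {u,w}` in an edge set `H`: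
`deg_H(u) + deg_H(w)`. -/
noncomputable def degE {V : Type*} (H : Finset (Sym2 V)) (e : Sym2 V) : ℕ :=
  Sym2.lift ⟨fun u w => degV H u + degV H w, fun _ _ => add_comm _ _⟩ e

/-- `M` is a matching: its edges are non-loops and pairwise vertex-disjoint. -/
def IsMatching {V : Type*} (M : Finset (Sym2 V)) : Prop :=
  (∀ e ∈ M, ¬ e.IsDiag) ∧ ∀ e ∈ M, ∀ f ∈ M, e ≠ f → ∀ v : V, v ∈ e → v ∉ f

/-- `matchNum F` = μ(F), the maximum size of a matching contained in the edge set `F`. -/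
noncomputable def matchNum {V : Type*} (F : Finset (Sym2 V)) : ℕ :=
  F.powerset.sup (fun M => if IsMatching M then M.card else 0)

theorem IsMatching.mono {V : Type*} {M N : Finset (Sym2 V)} (hM : IsMatching M) (h : N ⊆ M) :
    IsMatching N :=
  ⟨fun e he => hM.1 e (h he), fun e he f hf => hM.2 e (h he) f (h hf)⟩

theorem IsMatching.card_le_matchNum {V : Type*} {M F : Finset (Sym2 V)} (hM : IsMatching M)
    (h : M ⊆ F) : M.card ≤ matchNum F := by
  simpa [matchNum, hM] using Finset.le_sup (f := fun M => if IsMatching M then M.card else 0)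
    (Finset.mem_powerset.2 h)

theorem exists_isMatching_card_eq_matchNum {V : Type*} (F : Finset (Sym2 V)) :
    ∃ M ⊆ F, IsMatching M ∧ M.card = matchNum F := by
  obtain ⟨M, hMF, hM⟩ := Finset.exists_mem_eq_sup F.powerset ⟨∅, Finset.empty_mem_powerset F⟩
    (fun M => if IsMatching M then M.card else 0)
  by_cases h : IsMatching M
  · exact ⟨M, Finset.mem_powerset.1 hMF, h, by simpa [matchNum, h] using hM.symm⟩
  · refine ⟨∅, by simp, by simp [IsMatching], ?_⟩
    simpa [matchNum, h] using hM.symm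

/-- A sum of degrees counts every edge at most twice. -/
theorem sum_degV_le {V : Type*} (U : Finset (Sym2 V)) (S : Finset V) :
    ∑ v ∈ S, degV U v ≤ 2 * U.card := by
  have h := Finset.sum_card_bipartiteAbove_eq_sum_card_bipartiteBelow
    (s := S) (t := U) (fun (v : V) (e : Sym2 V) => v ∈ e)
  simp only [Finset.bipartiteAbove, Finset.bipartiteBelow] at h
  simp only [degV]
  rw [h, mul_comm]
  refine Finset.sum_le_card_nsmul U _ 2 fun e _ => ?_
  induction e with
  | _ a b =>
    refine (Finset.card_le_card (t := {a, b}) fun v hv => ?_).trans Finset.card_le_two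
    simpa using (Finset.mem_filter.1 hv).2

/-- A matching all of whose edges contain a vertex of `U`-degree more than `t` has at most
`2 * |U| / t` edges. -/
theorem IsMatching.card_le_of_exists_lt_degV {V : Type*} {M U : Finset (Sym2 V)}
    (hM : IsMatching M) {t : ℝ} (ht : 0 < t) (h : ∀ e ∈ M, ∃ v ∈ e, t < degV U v) :
    (M.card : ℝ) ≤ 2 * U.card / t := by
  have h' : ∀ e : Sym2 V, ∃ v ∈ e, e ∈ M → t < degV U v := fun e => by
    by_cases he : e ∈ M
    · obtain ⟨v, hv, hlt⟩ := h e he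
      exact ⟨v, hv, fun _ => hlt⟩
    · exact ⟨_, e.out_fst_mem, fun hc => absurd hc he⟩
  choose f hf hlt using h'
  have hinj : Set.InjOn f (M : Set (Sym2 V)) := by
    intro e he e' he' hee
    by_contra hne
    exact hM.2 e he e' he' hne (f e) (hf e) (hee ▸ hf e')
  have hsum : ∑ e ∈ M, degV U (f e) ≤ 2 * U.card := by
    rw [← Finset.sum_image (f := fun v => degV U v) hinj]
    exact sum_degV_le U _
  rw [le_div_iff₀ ht]
  calc (M.card : ℝ) * t = ∑ _e ∈ M, t := by simp
    _ ≤ ∑ e ∈ M, (degV U (f e) : ℝ) := Finset.sum_le_sum fun e he => (hlt e he).le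
    _ ≤ 2 * U.card := by exact_mod_cast hsum

/-- restricting H ∪ U to the vertices W (which contain all vertices of
U-degree at most t) loses at most 2·|U|/t from the matching number. -/
theorem matchNum_restrict_small (V : Type) (E H U : Finset (Sym2 V))
    (hE : ∀ e ∈ E, ¬ e.IsDiag) (hHE : H ⊆ E) (hUE : U ⊆ E) (hdisj : Disjoint H U)
    (t : ℝ) (ht : 0 < t) (W : Finset V)
    (hW : ∀ v : V, (degV U v : ℝ) ≤ t → v ∈ W)
    (F : Finset (Sym2 V)) (hF : F = (H ∪ U).filter (fun e => ∀ v ∈ e, v ∈ W)) :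
    (matchNum (H ∪ U) : ℝ) ≤ matchNum F + 2 * U.card / t := by
  obtain ⟨M, hMsub, hM, hcard⟩ := exists_isMatching_card_eq_matchNum (H ∪ U)
  have hgood : (M.filter fun e => ∀ v ∈ e, v ∈ W).card ≤ matchNum F :=
    (hM.mono (Finset.filter_subset _ _)).card_le_matchNum
      (hF ▸ Finset.filter_subset_filter _ hMsub)
  have hbad : ((M.filter fun e => ¬ ∀ v ∈ e, v ∈ W).card : ℝ) ≤ 2 * U.card / t := by
    refine (hM.mono (Finset.filter_subset _ _)).card_le_of_exists_lt_degV ht fun e he => ?_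
    obtain ⟨v, hve, hvW⟩ : ∃ v ∈ e, v ∉ W := by simpa using (Finset.mem_filter.1 he).2
    exact ⟨v, hve, not_le.1 fun hle => hvW (hW v hle)⟩
  rw [← hcard, ← Finset.card_filter_add_card_filter_not (s := M) (fun e => ∀ v ∈ e, v ∈ W)]
  push_cast
  exact add_le_add (by exact_mod_cast hgood) hbad
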